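/- Suppose R is a finite-dimensional commutative ring over ℂ with distinguished basis {χ_a}_{a∈Φ} and a unitary symmetric matrix S with S_{0b} > 0 for all b, such that the structure constants are N_{ab}^c = Σ_d S_{ad}S_{bd} conj(S_{cd})/S_{0d}. Then any vector v with N_a v = (S_{ab}/S_{0b}) v for all a ∈ Φ (where N_a is the matrix (N_a)_{bc} = N_{ab}^c) is a scalar multiple of the column (S_{cb})_{c∈Φ}. -/

import Mathlib

open Matrix Complex

theorem fusion_eigenvector_is_column_of_S
    {Φ : Type*} [Fintype Φ] [DecidableEq Φ] (z : Φ)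
    (S : Matrix Φ Φ ℂ)
    (hunit : Sᴴ * S = 1) (hsymm : S.IsSymm)
    (hpos : ∀ b, (S z b).im = 0 ∧ 0 < (S z b).re)
    (N : Φ → Φ → Φ → ℂ)
    (hN : ∀ a b c, N a b c = ∑ d, S a d * S b d * (starRingEnd ℂ) (S c d) / S z d)
    (b : Φ) (v : Φ → ℂ)
    (hv : ∀ a x, ∑ y, N a x y * v y = (S a b / S z b) * v x) :
    ∃ α : ℂ, ∀ c, v c = α * S c b := by 
  refine ⟨v z / S z b, fun a => ?_⟩
  have hne : ∀ d, S z d ≠ 0 := by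
    intro d h
    have h2 := (hpos d).2
    rw [h] at h2
    simp at h2
  have h1 : S * Sᴴ = 1 := mul_eq_one_comm.mp hunit
  have hNz : ∀ y, N a z y = (1 : Matrix Φ Φ ℂ) a y := by
    intro y
    rw [hN, ← h1, Matrix.mul_apply]
    refine Finset.sum_congr rfl fun d _ => ?_
    rw [Matrix.conjTranspose_apply, starRingEnd_apply]
    have := hne d
    field_simp
  have h := hv a z
  simp only [hNz, Matrix.one_apply, ite_mul, one_mul, zero_mul, Finset.sum_ite_eq,
    Finset.mem_univ, if_true] at h
  rw [h]
  ring
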